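/- arXiv:1104.3827 — 7 statements merged into one kernel-verified Lean document; each statement's English description precedes it below -/
import Mathlib

section
/- Let X be a topological space and let G be the additive group of all continuous functions from X to ℤ with the discrete topology. Suppose X is written as the union of a family (U_i)_{i ∈ I} of pairwise disjoint clopen subsets, and let a : G → ℤ be an additive homomorphism. Then the set of indices i ∈ I for which there exists an element of G with support contained in U_i on which a takes a nonzero value is finite. -/
/-- A homomorphism `(ℕ → ℤ) →+ ℤ` cannot be nonzero on all standard unit vectors. -/
theorem AddMonoidHom.exists_map_single_eq_zero (b : (ℕ → ℤ) →+ ℤ) :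
    ∃ n, b (Pi.single n 1) = 0 := by
  by_contra! hb
  let d : ℕ → ℤ := fun n => ∏ k ∈ Finset.range n, 2 * b (Pi.single k 1)
  have d_succ (n : ℕ) : d (n + 1) = d n * (2 * b (Pi.single n 1)) :=
    Finset.prod_range_succ _ _
  have d_ne (n : ℕ) : d n ≠ 0 :=
    Finset.prod_ne_zero_iff.2 fun k _ => mul_ne_zero two_ne_zero (hb k)
  have d_dvd {m n : ℕ} (h : m ≤ n) : d m ∣ d n :=
    Finset.prod_dvd_prod_of_subset _ _ _ (Finset.range_mono h)
  -- By cardinality, two distinct `0`-`1` combinations of the `d n` have the same image.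
  obtain ⟨s, t, hst, hne⟩ : ∃ s t : Set ℕ,
      b (s.indicator d) = b (t.indicator d) ∧ s ≠ t := by
    by_contra! h
    have hinj : Function.Injective fun s : Set ℕ => b (s.indicator d) := fun s t => h s t
    exact Function.cantor_injective _ (Equiv.intEquivNat.injective.comp hinj)
  classical
  have hex : ∃ n, ¬(n ∈ s ↔ n ∈ t) := by
    by_contra! h
    exact hne (Set.ext h)
  set n := Nat.find hex
  have hn : ¬(n ∈ s ↔ n ∈ t) := Nat.find_spec hex
  have hlt (m : ℕ) (hm : m < n) : m ∈ s ↔ m ∈ t := not_not.1 (Nat.find_min hex hm)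
  let x : ℕ → ℤ := s.indicator d - t.indicator d
  have hbx : b x = 0 := by rw [map_sub, hst, sub_self]
  have hxn : x n = d n ∨ x n = -d n := by
    by_cases h₁ : n ∈ s <;> by_cases h₂ : n ∈ t <;> simp_all [x]
  have hdvd (k : ℕ) : d (n + 1) ∣ (x - x n • Pi.single n 1 : ℕ → ℤ) k := by
    rcases lt_trichotomy k n with hk | rfl | hk
    · by_cases h : k ∈ t <;> simp [x, hk.ne, hlt k hk, h]
    · simp
    · have : d (n + 1) ∣ x k :=
        dvd_sub (by by_cases h : k ∈ s <;> simp [h, d_dvd hk])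
          (by by_cases h : k ∈ t <;> simp [h, d_dvd hk])
      simpa [hk.ne'] using this
  choose y hy using hdvd
  have hxy : x = x n • Pi.single n 1 + d (n + 1) • y := by
    rw [← sub_eq_iff_eq_add']
    exact funext hy
  have key : x n * b (Pi.single n 1) + d (n + 1) * b y = 0 := by
    rw [← hbx]
    conv_rhs => rw [hxy]
    simp only [map_add, map_zsmul, smul_eq_mul]
  have hprod : d n * b (Pi.single n 1) ≠ 0 := mul_ne_zero (d_ne n) (hb n)
  rw [d_succ] at key
  rcases hxn with h | h <;> rw [h] at key
  · have : 1 + 2 * b y = 0 := mul_left_cancel₀ hprod (by linear_combination key)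
    lia
  · have : -1 + 2 * b y = 0 := mul_left_cancel₀ hprod (by linear_combination key)
    lia

/-- A homomorphism `(I → ℤ) →+ ℤ` is nonzero on only finitely many standard unit vectors. -/
theorem AddMonoidHom.finite_setOf_map_single_ne_zero {I : Type*} [DecidableEq I]
    (b : (I → ℤ) →+ ℤ) : {i | b (Pi.single i 1) ≠ 0}.Finite := by
  by_contra hinf
  let f := Set.Infinite.natEmbedding _ hinf
  have hf : Function.Injective fun n => (f n : I) := Subtype.val_injective.comp f.injective
  obtain ⟨n, hn⟩ := AddMonoidHom.exists_map_single_eq_zero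
    (b.comp (Function.ExtendByZero.linearMap ℤ fun n => (f n : I)).toAddMonoidHom)
  refine (f n).2 (Eq.trans (congrArg b (funext fun i => ?_)) hn)
  change _ = Function.extend (fun n => (f n : I)) (Pi.single n 1) 0 i
  by_cases hi : ∃ m, (f m : I) = i
  · obtain ⟨m, rfl⟩ := hi
    rw [hf.extend_apply (Pi.single n 1) 0 m]
    simp [Pi.single_apply, Subtype.val_inj]
  · rw [Function.extend_apply' _ _ _ hi, Pi.single_eq_of_ne fun h => hi ⟨n, h.symm⟩]
    rfl

/-- Let `X` be a topological space and `G = C(X, ℤ)` the group of continuous functions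
from `X` to `ℤ` with the discrete topology.  If `X` is the union of a family `(U i)` of
pairwise disjoint clopen subsets and `a : G → ℤ` is an additive homomorphism, then only
finitely many indices `i` admit an element of `G` with support contained in `U i` on
which `a` is nonzero. -/
theorem finitely_many_supporting_pieces
    {X : Type} [TopologicalSpace X] {I : Type} (U : I → Set X)
    (hclopen : ∀ i, IsClopen (U i))
    (hdisj : Pairwise (Function.onFun Disjoint U))
    (hcover : ⋃ i, U i = Set.univ)
    (a : C(X, ℤ) →+ ℤ) :
    {i : I | ∃ g : C(X, ℤ), Function.support ⇑g ⊆ U i ∧ a g ≠ 0}.Finite := by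
  classical
  have hmem (x : X) : ∃ i, x ∈ U i := Set.mem_iUnion.1 (hcover ▸ Set.mem_univ x)
  choose idx hidx using hmem
  have idx_eq {x : X} {i : I} (hx : x ∈ U i) : idx x = i := by
    by_contra h
    exact Set.disjoint_left.1 (hdisj h) (hidx x) hx
  have hchoice (i : I) : ∃ g : C(X, ℤ), Function.support ⇑g ⊆ U i ∧
      ((∃ g : C(X, ℤ), Function.support ⇑g ⊆ U i ∧ a g ≠ 0) → a g ≠ 0) := by
    by_cases h : ∃ g : C(X, ℤ), Function.support ⇑g ⊆ U i ∧ a g ≠ 0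
    · obtain ⟨g, hg, hag⟩ := h
      exact ⟨g, hg, fun _ => hag⟩
    · exact ⟨0, by simp, fun h' => absurd h' h⟩
  choose g hsupp hg using hchoice
  -- The coefficients `c` are sent to the locally finite sum of the `c i • g i`.
  let F : (I → ℤ) →+ C(X, ℤ) :=
    { toFun := fun c =>
        { toFun := fun x => c (idx x) * g (idx x) x
          continuous_toFun := continuous_iff_continuousAt.2 fun x => by
            have hloc : (fun y => c (idx x) * g (idx x) y) =ᶠ[nhds x]
                fun y => c (idx y) * g (idx y) y := by
              filter_upwards [(hclopen (idx x)).isOpen.mem_nhds (hidx x)] with y hy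
              rw [idx_eq hy]
            exact ContinuousAt.congr (by fun_prop) hloc }
      map_zero' := by ext; simp
      map_add' := fun c c' => by ext; simp [add_mul] }
  have hF (i : I) : F (Pi.single i 1) = g i := by
    ext x
    change (Pi.single i 1 : I → ℤ) (idx x) * g (idx x) x = g i x
    by_cases hx : idx x = i
    · simp [hx]
    · have : g i x = 0 := by
        by_contra h
        exact hx (idx_eq (hsupp i h))
      simp [hx, this]
  refine (AddMonoidHom.finite_setOf_map_single_ne_zero (a.comp F)).subset fun i hi => ?_
  simpa [hF] using hg i hi
end

section
/- Let X be a topological space and let G be the additive group of all continuous functions from X to ℤ with the discrete topology. Suppose X is written as the union of a countable family (U_i)_{i ∈ I} of pairwise disjoint clopen subsets, let a : G → ℤ be an additive homomorphism, and let U be the union of the (finitely many) sets U_i for which there exists an element of G with support in U_i on which a is nonzero. Then a(g) = 0 for every g ∈ G whose support is contained in X − U; equivalently, the value of a at every g ∈ G is determined by the restriction of g to U. -/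
/-- An additive map `ℤ^ℕ → ℤ` killing finitely supported sequences kills every sequence whose
`n`-th term is divisible by `p ^ n`. -/
theorem map_pow_mul_eq_zero_of_map_single (φ : (ℕ → ℤ) →+ ℤ)
    (hφ : ∀ n z, φ (Pi.single n z) = 0) {p : ℕ} (hp : 1 < p) (u : ℕ → ℤ) :
    φ (fun n => (p : ℤ) ^ n * u n) = 0 := by
  have hdvd (k : ℕ) : (p : ℤ) ^ k ∣ φ (fun n => (p : ℤ) ^ n * u n) := by
    have hsplit : (fun n => (p : ℤ) ^ n * u n) =
        ∑ i ∈ Finset.range k, Pi.single i ((p : ℤ) ^ i * u i) +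
          ((p : ℤ) ^ k) • (fun n => if n < k then 0 else (p : ℤ) ^ (n - k) * u n) := by
      funext n
      simp only [Pi.add_apply, Finset.sum_apply, Pi.smul_apply, smul_eq_mul, Pi.single_apply,
        Finset.sum_ite_eq, Finset.mem_range]
      split_ifs with h
      · simp
      · rw [zero_add, ← mul_assoc, ← pow_add, Nat.add_sub_cancel' (not_lt.mp h)]
    rw [hsplit, map_add, map_sum, map_zsmul, Finset.sum_eq_zero fun i _ => hφ i _, zero_add,
      smul_eq_mul]
    exact dvd_mul_right _ _
  refine Int.eq_zero_of_dvd_of_natAbs_lt_natAbs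
    (hdvd (φ (fun n => (p : ℤ) ^ n * u n)).natAbs) ?_
  rw [Int.natAbs_pow, Int.natAbs_natCast]
  exact Nat.lt_pow_self hp

/-- An additive map `ℤ^ℕ → ℤ` killing finitely supported sequences is zero (Specker). -/
theorem map_eq_zero_of_map_single (φ : (ℕ → ℤ) →+ ℤ)
    (hφ : ∀ n z, φ (Pi.single n z) = 0) (c : ℕ → ℤ) : φ c = 0 := by
  have hbezout (n : ℕ) : ∃ u v : ℤ, c n = (2 : ℕ) ^ n * u + (3 : ℕ) ^ n * v := by
    have hcop : IsCoprime (((2 : ℕ) : ℤ) ^ n) (((3 : ℕ) : ℤ) ^ n) :=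
      (Nat.isCoprime_iff_coprime.mpr (by norm_num)).pow
    obtain ⟨s, t, hst⟩ := hcop
    exact ⟨s * c n, t * c n, by linear_combination -c n * hst⟩
  choose u v huv using hbezout
  have hc : c = (fun n => ((2 : ℕ) : ℤ) ^ n * u n) + fun n => ((3 : ℕ) : ℤ) ^ n * v n :=
    funext huv
  rw [hc, map_add, map_pow_mul_eq_zero_of_map_single φ hφ (by norm_num),
    map_pow_mul_eq_zero_of_map_single φ hφ (by norm_num), add_zero]

/-- If `X` is partitioned into countably many open sets `U i`, an additive map `C(X, ℤ) → ℤ`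
vanishes at `g` as soon as it vanishes on every function supported in the intersection of some
`U i` with the support of `g`. -/
theorem ContinuousMap.map_eq_zero_of_countable_partition {X I : Type*} [TopologicalSpace X]
    [Countable I] {U : I → Set X} (hopen : ∀ i, IsOpen (U i))
    (hdisj : Pairwise (Function.onFun Disjoint U)) (hcover : ⋃ i, U i = Set.univ)
    (a : C(X, ℤ) →+ ℤ) (g : C(X, ℤ))
    (hg : ∀ i, ∀ f : C(X, ℤ), Function.support f ⊆ U i ∩ Function.support g → a f = 0) :
    a g = 0 := by
  obtain ⟨e, he⟩ := exists_injective_nat I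
  have hmem (x : X) : ∃ i, x ∈ U i := Set.mem_iUnion.mp (hcover ▸ Set.mem_univ x)
  choose idx hidx using hmem
  have hloc : IsLocallyConstant idx := IsLocallyConstant.iff_exists_open idx |>.mpr fun x =>
    ⟨U (idx x), hopen _, hidx x, fun y hy => by
      by_contra hne
      exact Set.disjoint_left.mp (hdisj hne) (hidx y) hy⟩
  let ψ : (ℕ → ℤ) →+ C(X, ℤ) :=
    { toFun := fun c => ⟨fun x => c (e (idx x)) * g x,
        (hloc.comp fun i => c (e i)).continuous.mul g.continuous⟩
      map_zero' := by ext x; simp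
      map_add' := fun c d => by ext x; simp [add_mul] }
  have hψ (c : ℕ → ℤ) (x : X) : ψ c x = c (e (idx x)) * g x := rfl
  have hone : ψ (fun _ => 1) = g := by ext x; simp [hψ]
  rw [← hone]
  refine map_eq_zero_of_map_single (a.comp ψ) (fun n z => ?_) _
  rw [AddMonoidHom.comp_apply]
  have hsupp {x : X} (hx : x ∈ Function.support (ψ (Pi.single n z))) :
      e (idx x) = n ∧ x ∈ Function.support g := by
    rw [Function.mem_support, hψ] at hx
    refine ⟨?_, right_ne_zero_of_mul hx⟩
    by_contra hne
    exact hx (by rw [Pi.single_eq_of_ne hne, zero_mul])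
  by_cases hn : ∃ i, e i = n
  · obtain ⟨i, rfl⟩ := hn
    exact hg i _ fun x hx => ⟨he (hsupp hx).1 ▸ hidx x, (hsupp hx).2⟩
  · have hzero : ψ (Pi.single n z) = 0 := by
      ext x
      by_contra hx
      exact hn ⟨_, (hsupp hx).1⟩
    rw [hzero, map_zero]

/-- Let `X` be a topological space and `G = C(X, ℤ)` the group of continuous functions
from `X` to `ℤ` with the discrete topology.  Suppose `X` is the union of a countable
family `(U i)` of pairwise disjoint clopen subsets, let `a : G → ℤ` be an additive
homomorphism, and let `U` be the union of those `U i` that support an element of `G` on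
which `a` is nonzero.  Then `a` vanishes on every `g ∈ G` with support in `X − U`;
equivalently, `a g` is determined by the restriction of `g` to `U`. -/
theorem hom_vanishes_outside_supporting_pieces
    {X : Type} [TopologicalSpace X] {I : Type} [Countable I] (U : I → Set X)
    (hclopen : ∀ i, IsClopen (U i))
    (hdisj : Pairwise (Function.onFun Disjoint U))
    (hcover : ⋃ i, U i = Set.univ)
    (a : C(X, ℤ) →+ ℤ) :
    (∀ g : C(X, ℤ),
      Function.support ⇑g ⊆
        Set.univ \ (⋃ i ∈ {i : I | ∃ g' : C(X, ℤ), Function.support ⇑g' ⊆ U i ∧ a g' ≠ 0}, U i) →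
      a g = 0) ∧
    (∀ g₁ g₂ : C(X, ℤ),
      (∀ x ∈ ⋃ i ∈ {i : I | ∃ g' : C(X, ℤ), Function.support ⇑g' ⊆ U i ∧ a g' ≠ 0}, U i,
        g₁ x = g₂ x) →
      a g₁ = a g₂) := by
  have hvanish : ∀ g : C(X, ℤ), Function.support ⇑g ⊆
      Set.univ \ (⋃ i ∈ {i : I | ∃ g' : C(X, ℤ), Function.support ⇑g' ⊆ U i ∧ a g' ≠ 0}, U i) →
      a g = 0 := by
    intro g hg
    refine ContinuousMap.map_eq_zero_of_countable_partition (fun i => (hclopen i).isOpen) hdisj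
      hcover a g fun i f hf => ?_
    by_contra hne
    have hf_zero : f = 0 := by
      ext x
      by_contra hx
      exact (hg (hf hx).2).2 (Set.mem_biUnion ⟨f, fun y hy => (hf hy).1, hne⟩ (hf hx).1)
    exact hne (by rw [hf_zero, map_zero])
  refine ⟨hvanish, fun g₁ g₂ h => ?_⟩
  rw [← sub_eq_zero, ← map_sub]
  refine hvanish _ fun x hx => ⟨Set.mem_univ x, fun hxU => hx ?_⟩
  rw [ContinuousMap.sub_apply, h x hxU, sub_self]
end

section
/- Let X be a set with a coarse topology and a fine topology, both Hausdorff, such that: (i) X is compact and first-countable in the coarse topology; (ii) the coarse topology has a basis of open sets each of which is clopen in the fine topology; (iii) for every infinite subset S of X there exists a partition of X into pairwise disjoint fine-clopen subsets, infinitely many of which contain a member of S in their coarse-interior. Let G be the additive group of all functions X → ℤ continuous from the fine topology to the discrete topology on ℤ. Suppose a : G → ℤ is an additive homomorphism for which there exists a unique point x ∈ X such that every coarse neighborhood U of x contains the support of some g ∈ G with a(g) ≠ 0. Then a is an integer multiple of the evaluation homomorphism h_x : g ↦ g(x). -/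
open scoped Topology

/-- If every point other than `x` has a coarse neighborhood such that `a` kills the functions
supported in it, then `a` kills the functions vanishing on a coarse neighborhood of `x`. -/
theorem hom_eq_zero_of_vanishing_near
    {X : Type*} [TopologicalSpace X] (tc : TopologicalSpace X) (hcompact : @CompactSpace X tc)
    {B : Set (Set X)} (hB : @TopologicalSpace.IsTopologicalBasis X tc B)
    (hBclopen : ∀ U ∈ B, IsClopen U) (a : C(X, ℤ) →+ ℤ) {x : X}
    (huniq : ∀ y : X,
      (∀ U ∈ @nhds X tc y, ∃ g : C(X, ℤ), Function.support ⇑g ⊆ U ∧ a g ≠ 0) → y = x)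
    {U : Set X} (hU : U ∈ @nhds X tc x) (g : C(X, ℤ)) (hg : ∀ y ∈ U, g y = 0) : a g = 0 := by
  have hK : @IsCompact X tc (@interior X tc U)ᶜ :=
    (@isClosed_compl_iff X tc _).2 (@isOpen_interior X tc U) |>.isCompact
  obtain ⟨C, -, hKC, hC⟩ : ∃ C : Set X, IsClopen C ∧ (@interior X tc U)ᶜ ⊆ C ∧
      ∀ f : C(X, ℤ), Function.support ⇑f ⊆ C → a f = 0 := by
    refine @IsCompact.induction_on X tc _ hK
      (fun s => ∃ C : Set X, IsClopen C ∧ s ⊆ C ∧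
        ∀ f : C(X, ℤ), Function.support ⇑f ⊆ C → a f = 0) ?_ ?_ ?_ ?_
    · refine ⟨∅, isClopen_empty, subset_rfl, fun f hf => ?_⟩
      have : f = 0 := by
        ext y
        by_contra h
        exact hf h
      rw [this, map_zero]
    · rintro s t hst ⟨C, hC, htC, h⟩
      exact ⟨C, hC, hst.trans htC, h⟩
    · rintro s t ⟨C, hC, hsC, h⟩ ⟨D, hD, htD, h'⟩
      refine ⟨C ∪ D, hC.union hD, Set.union_subset_union hsC htD, fun f hf => ?_⟩
      let f₁ : C(X, ℤ) := ⟨C.indicator f, f.continuous.indicator (by simp [hC.frontier_eq])⟩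
      let f₂ : C(X, ℤ) :=
        ⟨Cᶜ.indicator f, f.continuous.indicator (by simp [hC.compl.frontier_eq])⟩
      have hsum : f = f₁ + f₂ := by
        ext y
        exact (congrFun (Set.indicator_self_add_compl C (f : X → ℤ)) y).symm
      have h₁ : a f₁ = 0 := h f₁ Set.support_indicator_subset
      have h₂ : a f₂ = 0 := by
        refine h' f₂ fun y hy => ?_
        have hy' : y ∈ Cᶜ ∩ Function.support f := by
          rw [← Set.support_indicator]
          exact hy
        exact (hf hy'.2).resolve_left hy'.1
      rw [hsum, map_add, h₁, h₂, add_zero]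
    · intro y hy
      have hyx : y ≠ x := by
        rintro rfl
        exact hy ((@mem_interior_iff_mem_nhds X tc _ _).2 hU)
      have hy' := mt (huniq y) hyx
      push Not at hy'
      obtain ⟨V, hV, hVa⟩ := hy'
      obtain ⟨W, hWB, hyW, hWV⟩ :=
        (@TopologicalSpace.IsTopologicalBasis.mem_nhds_iff X tc _ _ _ hB).1 hV
      exact ⟨W, @mem_nhdsWithin_of_mem_nhds X tc _ _ _
        (@TopologicalSpace.IsTopologicalBasis.mem_nhds X tc _ _ _ hB hWB hyW),
        W, hBclopen W hWB, subset_rfl, fun f hf => hVa f (hf.trans hWV)⟩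
  exact hC g fun y hy => hKC fun hyU => hy (hg y ((@interior_subset X tc U) hyU))

/-- If `a` kills the functions vanishing on `U`, then divisibility of values on `U` passes to
the value of `a`. -/
theorem hom_dvd_of_dvd_on {X : Type*} [TopologicalSpace X] (a : C(X, ℤ) →+ ℤ) {U : Set X}
    (hU : ∀ g : C(X, ℤ), (∀ y ∈ U, g y = 0) → a g = 0) (d : ℤ) (f : C(X, ℤ))
    (hf : ∀ y ∈ U, d ∣ f y) : d ∣ a f := by
  let q : C(X, ℤ) :=
    ⟨fun y => f y / d, (continuous_of_discreteTopology (f := fun m : ℤ => m / d)).comp f.continuous⟩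
  have h : a (f - d • q) = 0 := hU _ fun y hy => by
    change f y - d • (f y / d) = 0
    rw [smul_eq_mul, Int.mul_ediv_cancel' (hf y hy), sub_self]
  rw [map_sub, map_zsmul, sub_eq_zero, smul_eq_mul] at h
  exact ⟨_, h⟩

/-- Multiplying `g` by a function of the first index `n` with `y ∉ W n` keeps it continuous,
provided that `g` vanishes at all points lying in every `W n`. -/
theorem continuous_mul_first_exit {X : Type*} [TopologicalSpace X] {W : ℕ → Set X}
    (hW : ∀ n, IsClopen (W n)) (g : C(X, ℤ)) (hg : ∀ y, (∀ n, y ∈ W n) → g y = 0) (φ : ℕ → ℤ) :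
    Continuous fun y => g y * φ (sInf {n | y ∉ W n}) := by
  refine IsLocallyConstant.continuous ((IsLocallyConstant.iff_eventually_eq _).2 fun y => ?_)
  have hgy : ∀ᶠ z in 𝓝 y, g z = g y :=
    (IsLocallyConstant.iff_eventually_eq _).1
      ((IsLocallyConstant.iff_continuous _).2 g.continuous) y
  by_cases h0 : g y = 0
  · filter_upwards [hgy] with z hz
    rw [hz, h0, zero_mul, zero_mul]
  have hne : {n | y ∉ W n}.Nonempty := by
    by_contra h
    refine h0 (hg y fun n => ?_)
    by_contra hn
    exact h ⟨n, hn⟩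
  have hexit : y ∉ W (sInf {n | y ∉ W n}) := Nat.sInf_mem hne
  have hstay : ∀ i ∈ Set.Iio (sInf {n | y ∉ W n}), y ∈ W i := fun i hi => by
    by_contra h
    exact Nat.notMem_of_lt_sInf hi h
  have hstay' : ∀ᶠ z in 𝓝 y, ∀ i ∈ Set.Iio (sInf {n | y ∉ W n}), z ∈ W i :=
    (Filter.eventually_all_finite (Set.finite_Iio _)).2 fun i hi =>
      (hW i).isOpen.mem_nhds (hstay i hi)
  filter_upwards [hgy, hstay', (hW _).compl.isOpen.mem_nhds hexit] with z hz hzstay hzexit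
  have hk : sInf {n | z ∉ W n} = sInf {n | y ∉ W n} := by
    refine le_antisymm (Nat.sInf_le hzexit) (le_of_not_gt fun hlt => ?_)
    exact Nat.sInf_mem (s := {n | z ∉ W n}) ⟨_, hzexit⟩ (hzstay _ hlt)
  rw [hz, hk]

/-- Let `X` carry a fine topology (the ambient instance `tf`) and a coarse topology
`tc`, both Hausdorff, such that: (i) `X` is compact and first-countable in the coarse
topology; (ii) the coarse topology has a basis of open sets each clopen in the fine
topology; (iii) every infinite `S ⊆ X` admits a partition of `X` into pairwise
disjoint fine-clopen sets, infinitely many of which contain a member of `S` in their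
coarse interior.  Let `G = C(X, ℤ)` (with `ℤ` discrete).  If `a : G → ℤ` is an
additive homomorphism admitting a unique point `x ∈ X` such that every coarse
neighborhood of `x` contains the support of some `g ∈ G` with `a(g) ≠ 0`, then `a` is
an integer multiple of the evaluation homomorphism `h_x : g ↦ g(x)`. -/
theorem hom_with_unique_localization_point_is_multiple_of_evaluation
    (X : Type) [tf : TopologicalSpace X] (tc : TopologicalSpace X)
    (hT2fine : T2Space X) (hT2coarse : @T2Space X tc)
    (hcompact : @CompactSpace X tc)
    (hfirst : @FirstCountableTopology X tc)
    (hbasis : ∃ B : Set (Set X),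
      @TopologicalSpace.IsTopologicalBasis X tc B ∧ ∀ U ∈ B, IsClopen U)
    (hpartition : ∀ S : Set X, S.Infinite →
      ∃ P : Set (Set X), (∀ U ∈ P, IsClopen U) ∧
        (∀ U ∈ P, ∀ V ∈ P, U ≠ V → Disjoint U V) ∧
        ⋃₀ P = Set.univ ∧
        {U ∈ P | (S ∩ @interior X tc U).Nonempty}.Infinite)
    (a : C(X, ℤ) →+ ℤ) (x : X)
    (hx : ∀ U ∈ @nhds X tc x, ∃ g : C(X, ℤ), Function.support ⇑g ⊆ U ∧ a g ≠ 0)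
    (huniq : ∀ y : X,
      (∀ U ∈ @nhds X tc y, ∃ g : C(X, ℤ), Function.support ⇑g ⊆ U ∧ a g ≠ 0) → y = x) :
    ∃ c : ℤ, ∀ g : C(X, ℤ), a g = c * g x := by
  obtain ⟨B, hB, hBclopen⟩ := hbasis
  have hvan : ∀ U ∈ @nhds X tc x, ∀ g : C(X, ℤ), (∀ y ∈ U, g y = 0) → a g = 0 :=
    fun U hU g hg => hom_eq_zero_of_vanishing_near tc hcompact hB hBclopen a huniq hU g hg
  have hcount := @FirstCountableTopology.nhds_generated_countable X tc hfirst x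
  obtain ⟨V, hV⟩ := (@nhds X tc x).exists_antitone_basis
  have hW : ∀ n, ∃ W ∈ B, x ∈ W ∧ W ⊆ V n := fun n =>
    (@TopologicalSpace.IsTopologicalBasis.mem_nhds_iff X tc _ _ _ hB).1 (hV.mem n)
  choose W hWB hxW hWV using hW
  have hWnhds : ∀ n, W n ∈ @nhds X tc x := fun n =>
    @TopologicalSpace.IsTopologicalBasis.mem_nhds X tc _ _ _ hB (hWB n) (hxW n)
  have hWx : ∀ y, (∀ n, y ∈ W n) → y = x := fun y hy => by
    by_contra hne
    have hmem : ({y}ᶜ : Set X) ∈ @nhds X tc x :=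
      @compl_singleton_mem_nhds X tc (@T2Space.t1Space X tc hT2coarse) _ _ (Ne.symm hne)
    obtain ⟨n, hn⟩ := hV.mem_iff.1 hmem
    exact hn (hWV n (hy n)) rfl
  suffices hzero : ∀ g : C(X, ℤ), g x = 0 → a g = 0 by
    refine ⟨a 1, fun g => ?_⟩
    have h : a (g - g x • 1) = 0 := hzero _ (by simp)
    rw [map_sub, map_zsmul, sub_eq_zero, smul_eq_mul] at h
    rw [h, mul_comm]
  intro g hgx
  have hgW : ∀ y, (∀ n, y ∈ W n) → g y = 0 := fun y hy => by rw [hWx y hy, hgx]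
  have hcont := continuous_mul_first_exit (fun n => hBclopen _ (hWB n)) g hgW
  set p : ℤ := |a g| + 2 with hp
  let H : C(X, ℤ) := ⟨_, hcont fun k => p ^ k⟩
  let F : C(X, ℤ) := ⟨_, hcont fun k => ∑ i ∈ Finset.range k, p ^ i⟩
  have hHF : H = g + (p - 1) • F := by
    ext y
    change g y * p ^ sInf {n | y ∉ W n} =
      g y + (p - 1) • (g y * ∑ i ∈ Finset.range (sInf {n | y ∉ W n}), p ^ i)
    have := geom_sum_mul p (sInf {n | y ∉ W n})
    rw [smul_eq_mul]
    linear_combination (-g y) * this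
  have hdvd : ∀ N : ℕ, p ^ N ∣ a H := fun N => by
    refine hom_dvd_of_dvd_on a (U := ⋂ i ∈ Set.Iio N, W i) (hvan _ ?_) _ H fun y hy => ?_
    · exact (Filter.biInter_mem (Set.finite_Iio N)).2 fun i _ => hWnhds i
    · change p ^ N ∣ g y * p ^ sInf {n | y ∉ W n}
      by_cases hyW : ∀ n, y ∈ W n
      · rw [hgW y hyW, zero_mul]
        exact dvd_zero _
      · push Not at hyW
        refine Dvd.dvd.mul_left (pow_dvd_pow p (le_of_not_gt fun hlt => ?_)) _
        exact Nat.sInf_mem (s := {n | y ∉ W n}) hyW (Set.mem_iInter₂.1 hy _ hlt)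
  have hp2 : 2 ≤ p := by have := abs_nonneg (a g); omega
  have hH0 : a H = 0 := by
    by_contra hne
    have hfin : FiniteMultiplicity p (a H) :=
      Int.finiteMultiplicity_iff.2 ⟨by omega, hne⟩
    obtain ⟨n, hn⟩ := hfin
    exact hn (hdvd _)
  rw [hHF, map_add, map_zsmul, smul_eq_mul] at hH0
  have hdiv : p - 1 ∣ a g := ⟨-a F, by linear_combination hH0⟩
  exact Int.eq_zero_of_abs_lt_dvd hdiv (by omega)
end

section
/- There is a topology on the real unit interval [0,1] whose open sets are exactly the sets U ⊆ [0,1] with the following property: for every irrational x ∈ U and every ε > 0 there exists δ > 0 such that every closed interval [r,s] ⊆ [0,1] with rational endpoints which contains x and has length s − r < δ contains a finite family of pairwise disjoint closed subintervals with rational endpoints, lying in U ∩ [r,s], of total length at least (1−ε)(s−r). In particular, this class of sets contains ∅ and [0,1] and is closed under arbitrary unions and under finite intersections. -/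
/-- The defining property of open sets of the fine topology on `[0,1]`: for every
irrational `x ∈ U` and every `ε > 0` there is `δ > 0` such that every closed interval
`[r,s] ⊆ [0,1]` with rational endpoints containing `x`, of length `< δ`, contains a
finite family of pairwise disjoint closed subintervals with rational endpoints, lying
in `U ∩ [r,s]`, of total length at least `(1-ε)(s-r)`. -/
def FineOpen (U : Set unitInterval) : Prop :=
  ∀ x ∈ U, Irrational (x : ℝ) → ∀ ε : ℝ, 0 < ε → ∃ δ : ℝ, 0 < δ ∧
    ∀ r s : ℚ, 0 ≤ (r : ℝ) → (s : ℝ) ≤ 1 → r ≤ s →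
      (r : ℝ) ≤ (x : ℝ) → (x : ℝ) ≤ (s : ℝ) → (s : ℝ) - (r : ℝ) < δ →
      ∃ (n : ℕ) (a b : Fin n → ℚ),
        (∀ i, r ≤ a i ∧ a i ≤ b i ∧ b i ≤ s) ∧
        (∀ i, ∀ y : unitInterval, (a i : ℝ) ≤ (y : ℝ) → (y : ℝ) ≤ (b i : ℝ) → y ∈ U) ∧
        (∀ i j, i ≠ j → Disjoint (Set.Icc (a i) (b i)) (Set.Icc (a j) (b j))) ∧
        (1 - ε) * ((s : ℝ) - (r : ℝ)) ≤ ∑ i, ((b i : ℝ) - (a i : ℝ))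

open MeasureTheory

/-- Closed intervals with rational endpoints that are disjoint in `ℚ` are disjoint in `ℝ`. -/
lemma disjoint_Icc_ratCast {a b c d : ℚ} (h : Disjoint (Set.Icc a b) (Set.Icc c d)) :
    Disjoint (Set.Icc (a : ℝ) b) (Set.Icc (c : ℝ) d) := by
  rw [Set.disjoint_iff_inter_eq_empty, Set.Icc_inter_Icc, Set.Icc_eq_empty_iff] at h ⊢
  exact_mod_cast h

/-- The measure of a finite disjoint union of rational intervals is their total length. -/
lemma volume_real_iUnion_Icc_ratCast {ι : Type*} [Fintype ι] {a b : ι → ℚ} (hab : ∀ i, a i ≤ b i)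
    (hd : ∀ i j, i ≠ j → Disjoint (Set.Icc (a i) (b i)) (Set.Icc (a j) (b j))) :
    volume.real (⋃ i, Set.Icc (a i : ℝ) (b i)) = ∑ i, ((b i : ℝ) - a i) := by
  rw [measureReal_iUnion_fintype (fun i j hij => disjoint_Icc_ratCast (hd i j hij))
    (fun _ => measurableSet_Icc) (fun i => measure_Icc_lt_top.ne)]
  exact Finset.sum_congr rfl fun i _ =>
    Real.volume_real_Icc_of_le (by exact_mod_cast hab i)

/-- The pairwise intersections of two finite disjoint families of subintervals of `[r, s]` form a
finite disjoint family, whose total length satisfies the inclusion-exclusion bound. -/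
lemma exists_inter_family {m n : ℕ} {r s : ℚ} {a b : Fin m → ℚ} {c d : Fin n → ℚ} (hrs : r ≤ s)
    (hab : ∀ i, r ≤ a i ∧ a i ≤ b i ∧ b i ≤ s) (hcd : ∀ j, r ≤ c j ∧ c j ≤ d j ∧ d j ≤ s)
    (hdab : ∀ i j, i ≠ j → Disjoint (Set.Icc (a i) (b i)) (Set.Icc (a j) (b j)))
    (hdcd : ∀ i j, i ≠ j → Disjoint (Set.Icc (c i) (d i)) (Set.Icc (c j) (d j))) :
    ∃ (k : ℕ) (e f : Fin k → ℚ),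
      (∀ l, e l ≤ f l ∧ ∃ i j, e l = max (a i) (c j) ∧ f l = min (b i) (d j)) ∧
      (∀ l l', l ≠ l' → Disjoint (Set.Icc (e l) (f l)) (Set.Icc (e l') (f l'))) ∧
      ∑ i, ((b i : ℝ) - a i) + ∑ j, ((d j : ℝ) - c j) - ((s : ℝ) - r) ≤
        ∑ l, ((f l : ℝ) - e l) := by
  let ι := {p : Fin m × Fin n // max (a p.1) (c p.2) ≤ min (b p.1) (d p.2)}
  let e : ι → ℚ := fun p => max (a p.1.1) (c p.1.2)
  let f : ι → ℚ := fun p => min (b p.1.1) (d p.1.2)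
  have hdisj : ∀ p q : ι, p ≠ q → Disjoint (Set.Icc (e p) (f p)) (Set.Icc (e q) (f q)) := by
    intro p q hpq
    have he : ∀ p : ι, Set.Icc (e p) (f p) =
        Set.Icc (a p.1.1) (b p.1.1) ∩ Set.Icc (c p.1.2) (d p.1.2) :=
      fun p => Set.Icc_inter_Icc.symm
    rw [he, he]
    by_cases h : p.1.1 = q.1.1
    · have h' : p.1.2 ≠ q.1.2 := fun h' => hpq (Subtype.ext (Prod.ext h h'))
      exact (hdcd _ _ h').mono Set.inter_subset_right Set.inter_subset_right
    · exact (hdab _ _ h).mono Set.inter_subset_left Set.inter_subset_left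
  have hinter : (⋃ i, Set.Icc (a i : ℝ) (b i)) ∩ (⋃ j, Set.Icc (c j : ℝ) (d j)) =
      ⋃ p : ι, Set.Icc (e p : ℝ) (f p) := by
    ext y
    simp only [Set.mem_inter_iff, Set.mem_iUnion, Set.mem_Icc, e, f, Rat.cast_max, Rat.cast_min,
      max_le_iff, le_min_iff]
    constructor
    · rintro ⟨⟨i, hi⟩, j, hj⟩
      refine ⟨⟨(i, j), ?_⟩, ⟨hi.1, hj.1⟩, hi.2, hj.2⟩
      have : ((max (a i) (c j) : ℚ) : ℝ) ≤ ((min (b i) (d j) : ℚ) : ℝ) := by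
        push_cast
        exact (max_le hi.1 hj.1).trans (le_min hi.2 hj.2)
      exact_mod_cast this
    · rintro ⟨p, h₁, h₂⟩
      exact ⟨⟨p.1.1, h₁.1, h₂.1⟩, p.1.2, h₁.2, h₂.2⟩
  have hsub : ∀ {k : ℕ} {u v : Fin k → ℚ}, (∀ i, r ≤ u i ∧ u i ≤ v i ∧ v i ≤ s) →
      (⋃ i, Set.Icc (u i : ℝ) (v i)) ⊆ Set.Icc (r : ℝ) s := fun h =>
    Set.iUnion_subset fun i => Set.Icc_subset_Icc (by exact_mod_cast (h i).1)
      (by exact_mod_cast (h i).2.2)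
  have hunion : volume.real ((⋃ i, Set.Icc (a i : ℝ) (b i)) ∪ (⋃ j, Set.Icc (c j : ℝ) (d j))) ≤
      (s : ℝ) - r := by
    rw [← Real.volume_real_Icc_of_le (show (r : ℝ) ≤ s by exact_mod_cast hrs)]
    exact measureReal_mono (Set.union_subset (hsub hab) (hsub hcd)) measure_Icc_lt_top.ne
  have hsum := measureReal_union_add_inter (μ := volume) (s := ⋃ i, Set.Icc (a i : ℝ) (b i))
    (t := ⋃ j, Set.Icc (c j : ℝ) (d j)) (MeasurableSet.iUnion fun _ => measurableSet_Icc)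
    (measure_ne_top_of_subset (hsub hab) measure_Icc_lt_top.ne)
    (measure_ne_top_of_subset (hsub hcd) measure_Icc_lt_top.ne)
  rw [hinter, volume_real_iUnion_Icc_ratCast (fun i => (hab i).2.1) hdab,
    volume_real_iUnion_Icc_ratCast (fun i => (hcd i).2.1) hdcd,
    volume_real_iUnion_Icc_ratCast (fun p : ι => p.2) hdisj] at hsum
  let φ := (Fintype.equivFin ι).symm
  refine ⟨Fintype.card ι, e ∘ φ, f ∘ φ, fun l => ⟨(φ l).2, _, _, rfl, rfl⟩,
    fun l l' h => hdisj _ _ (φ.injective.ne h), ?_⟩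
  have hφ : ∑ l, (((f ∘ φ) l : ℝ) - (e ∘ φ) l) = ∑ p, ((f p : ℝ) - e p) :=
    φ.sum_comp fun p => (f p : ℝ) - e p
  linarith

lemma FineOpen.univ : FineOpen Set.univ := by
  intro x _ _ ε hε
  refine ⟨1, one_pos, fun r s _ _ hrs _ _ _ => ⟨1, fun _ => r, fun _ => s,
    fun _ => ⟨le_rfl, hrs, le_rfl⟩,
    fun _ _ _ _ => Set.mem_univ _, fun i j h => (h (Subsingleton.elim i j)).elim, ?_⟩⟩
  have : (r : ℝ) ≤ s := by exact_mod_cast hrs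
  simp only [Finset.univ_unique, Finset.sum_const, Finset.card_singleton, one_smul]
  nlinarith

lemma FineOpen.inter {U V : Set unitInterval} (hU : FineOpen U) (hV : FineOpen V) :
    FineOpen (U ∩ V) := by
  intro x hx hirr ε hε
  obtain ⟨δ₁, hδ₁, h₁⟩ := hU x hx.1 hirr (ε / 2) (half_pos hε)
  obtain ⟨δ₂, hδ₂, h₂⟩ := hV x hx.2 hirr (ε / 2) (half_pos hε)
  refine ⟨min δ₁ δ₂, lt_min hδ₁ hδ₂, fun r s hr hs hrs hrx hxs hlt => ?_⟩
  obtain ⟨m, a, b, hab, habU, hdab, hsab⟩ :=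
    h₁ r s hr hs hrs hrx hxs (hlt.trans_le (min_le_left _ _))
  obtain ⟨n, c, d, hcd, hcdV, hdcd, hscd⟩ :=
    h₂ r s hr hs hrs hrx hxs (hlt.trans_le (min_le_right _ _))
  obtain ⟨k, e, f, hef, hdef, hsef⟩ := exists_inter_family hrs hab hcd hdab hdcd
  refine ⟨k, e, f, fun l => ?_, fun l y hey hyf => ?_, hdef, by linarith⟩
  · obtain ⟨hle, i, j, he, hf⟩ := hef l
    exact ⟨he ▸ (hab i).1.trans (le_max_left _ _), hle, hf ▸ (min_le_left _ _).trans (hab i).2.2⟩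
  · obtain ⟨-, i, j, he, hf⟩ := hef l
    rw [he, Rat.cast_max, max_le_iff] at hey
    rw [hf, Rat.cast_min, le_min_iff] at hyf
    exact ⟨habU i y hey.1 hyf.1, hcdV j y hey.2 hyf.2⟩

lemma FineOpen.sUnion {S : Set (Set unitInterval)} (hS : ∀ U ∈ S, FineOpen U) :
    FineOpen (⋃₀ S) := by
  rintro x ⟨U, hUS, hxU⟩ hirr ε hε
  obtain ⟨δ, hδ, h⟩ := hS U hUS x hxU hirr ε hε
  refine ⟨δ, hδ, fun r s hr hs hrs hrx hxs hlt => ?_⟩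
  obtain ⟨n, a, b, hab, habU, hd, hsum⟩ := h r s hr hs hrs hrx hxs hlt
  exact ⟨n, a, b, hab, fun i y hy hy' => ⟨U, hUS, habU i y hy hy'⟩, hd, hsum⟩

/-- The sets `U ⊆ [0,1]` satisfying the "perforated neighborhood" condition at every
irrational point form the open sets of a topology on `[0,1]`; in particular this class
of sets contains `∅` and `[0,1]` and is closed under arbitrary unions and finite
intersections. -/
theorem fineOpen_isTopology :
    ∃ t : TopologicalSpace unitInterval, ∀ U : Set unitInterval, @IsOpen _ t U ↔ FineOpen U :=
  ⟨{ IsOpen := FineOpen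
     isOpen_univ := FineOpen.univ
     isOpen_inter := fun _ _ => FineOpen.inter
     isOpen_sUnion := fun _ => FineOpen.sUnion }, fun _ => Iff.rfl⟩
end

section
/- Let B be the additive group of all bounded functions ℕ → ℤ. For each ultrafilter 𝒰 on ℕ, let h_𝒰 : B → ℤ be the additive homomorphism sending g ∈ B to the unique integer k such that {n ∈ ℕ : g(n) = k} belongs to 𝒰 (such k exists and is unique since g assumes only finitely many values and 𝒰 is an ultrafilter). Then the family (h_𝒰), indexed by all ultrafilters 𝒰 on ℕ, is ℤ-linearly independent in the group Hom(B, ℤ) of additive homomorphisms B → ℤ. -/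
/-- The additive subgroup `B ⊆ ℤ^ℕ` of bounded functions `ℕ → ℤ`, i.e. those whose set
of values is finite. -/
def boundedIntSeqs : AddSubgroup (ℕ → ℤ) where
  carrier := {f : ℕ → ℤ | (Set.range f).Finite}
  zero_mem' := (Set.finite_singleton (0 : ℤ)).subset (by rintro _ ⟨n, rfl⟩; simp)
  add_mem' {f g} hf hg := (Set.Finite.image2 (· + ·) hf hg).subset
    (by rintro _ ⟨n, rfl⟩; exact ⟨f n, ⟨n, rfl⟩, g n, ⟨n, rfl⟩, rfl⟩)
  neg_mem' {f} hf := (hf.image Neg.neg).subset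
    (by rintro _ ⟨n, rfl⟩; exact ⟨f n, ⟨n, rfl⟩, rfl⟩)

/-- An ultrafilter can be separated from finitely many other ultrafilters by one set. -/
theorem Ultrafilter.exists_mem_forall_notMem {α : Type*} (s : Finset (Ultrafilter α))
    (𝒰 : Ultrafilter α) : ∃ A ∈ 𝒰, ∀ 𝒱 ∈ s, 𝒱 ≠ 𝒰 → A ∉ 𝒱 := by
  have separate : ∀ 𝒱 : Ultrafilter α, ∃ A ∈ 𝒰, 𝒱 ≠ 𝒰 → A ∉ 𝒱 := by
    intro 𝒱
    by_contra! hA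
    have hne : 𝒱 ≠ 𝒰 := (hA Set.univ Filter.univ_mem).1
    exact hne (Ultrafilter.coe_le_coe.mp fun A hAU => (hA A hAU).2)
  choose A hA hAV using separate
  refine ⟨⋂ 𝒱 ∈ s, A 𝒱, (Filter.biInter_finset_mem s).mpr fun 𝒱 _ => hA 𝒱, ?_⟩
  intro 𝒱 hs hne hmem
  exact hAV 𝒱 hne (Filter.mem_of_superset hmem (Set.biInter_subset_of_mem hs))

/-- The indicator function of a set of natural numbers, as a bounded function. -/
noncomputable def boundedIndicator (A : Set ℕ) : boundedIntSeqs :=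
  ⟨A.indicator 1, (Set.toFinite {0, 1}).subset (by
    rintro _ ⟨n, rfl⟩
    by_cases hn : n ∈ A <;> simp [hn])⟩

theorem eq_of_eventually_eq_const {α β : Type*} {𝒰 : Ultrafilter α} {g : α → β} {a b : β}
    {A : Set α} (ha : {n | g n = a} ∈ 𝒰) (hA : A ∈ 𝒰) (hb : ∀ n ∈ A, g n = b) : a = b := by
  obtain ⟨n, hna, hnA⟩ := 𝒰.nonempty_of_mem (Filter.inter_mem ha hA)
  exact hna.symm.trans (hb n hnA)

/-- For each ultrafilter `𝒰` on `ℕ`, let `h_𝒰 : B → ℤ` be the homomorphism sending a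
bounded `g : ℕ → ℤ` to the unique integer `k` with `{n | g n = k} ∈ 𝒰`.  Then the
family `(h_𝒰)`, indexed by all ultrafilters on `ℕ`, is `ℤ`-linearly independent in
`Hom(B, ℤ)`.  (The family is specified by its defining property, which determines it
uniquely.) -/
theorem ultrafilter_limit_homs_linearIndependent
    (h : Ultrafilter ℕ → (boundedIntSeqs →+ ℤ))
    (hspec : ∀ (𝒰 : Ultrafilter ℕ) (g : boundedIntSeqs),
      {n : ℕ | (g : ℕ → ℤ) n = h 𝒰 g} ∈ 𝒰) :
    LinearIndependent ℤ h := by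
  rw [linearIndependent_iff']
  intro s c hsum 𝒰 hs
  obtain ⟨A, hA, hAV⟩ := Ultrafilter.exists_mem_forall_notMem s 𝒰
  have hone : h 𝒰 (boundedIndicator A) = 1 :=
    eq_of_eventually_eq_const (hspec 𝒰 _) hA fun n hn => by simp [boundedIndicator, hn]
  have hzero : ∀ 𝒱 ∈ s, 𝒱 ≠ 𝒰 → h 𝒱 (boundedIndicator A) = 0 := fun 𝒱 hV hne =>
    eq_of_eventually_eq_const (hspec 𝒱 _) (Ultrafilter.compl_mem_iff_notMem.mpr (hAV 𝒱 hV hne))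
      fun n hn => Set.indicator_of_notMem hn 1
  have heval := DFunLike.congr_fun hsum (boundedIndicator A)
  rw [AddMonoidHom.finsetSum_apply, Finset.sum_eq_single_of_mem 𝒰 hs] at heval
  · simpa [hone] using heval
  · intro 𝒱 hV hne
    simp [hzero 𝒱 hV hne]
end

section
/- Let S be a set of integers and let G_S be the additive subgroup of ℤ^ℕ generated by the set ({0} ∪ S)^ℕ of all functions ℕ → ℤ taking values in {0} ∪ S. Then G_S = {f ∈ ℤ^ℕ : there exists k ∈ ℕ such that every value assumed by f is a sum of at most k terms (counting repetitions) each belonging to S ∪ (−S)}. -/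
/-- A function whose values lie in `{0} ∪ S ∪ (−S)` is a difference of two functions with values
in `{0} ∪ S`. -/
lemma mem_closure_of_forall_eq_zero_or_mem_or_neg_mem (S : Set ℤ) (g : ℕ → ℤ)
    (hg : ∀ n, g n = 0 ∨ g n ∈ S ∨ -g n ∈ S) :
    g ∈ AddSubgroup.closure {f : ℕ → ℤ | ∀ n, f n = 0 ∨ f n ∈ S} := by
  classical
  have hsplit : g = (fun n => if g n ∈ S then g n else 0) -
      (fun n => if g n ∈ S then 0 else -g n) := by
    funext n
    by_cases h : g n ∈ S <;> simp [h]
  rw [hsplit]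
  refine sub_mem (AddSubgroup.subset_closure fun n => ?_) (AddSubgroup.subset_closure fun n => ?_)
  · by_cases h : g n ∈ S <;> simp [h]
  · by_cases h : g n ∈ S
    · simp [h]
    · simpa [h] using hg n

/-- A function whose values are sums of at most `k` terms from `S ∪ (−S)` lies in the subgroup
generated by the functions with values in `{0} ∪ S`. -/
lemma mem_closure_of_forall_eq_sum (S : Set ℤ) (k : ℕ) (f : ℕ → ℤ)
    (hf : ∀ n : ℕ, ∃ m : ℕ, m ≤ k ∧
      ∃ t : Fin m → ℤ, (∀ i, t i ∈ S ∨ -t i ∈ S) ∧ f n = ∑ i, t i) :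
    f ∈ AddSubgroup.closure {f : ℕ → ℤ | ∀ n, f n = 0 ∨ f n ∈ S} := by
  induction k generalizing f with
  | zero =>
    have hzero : f = 0 := by
      funext n
      obtain ⟨m, hm, t, -, h⟩ := hf n
      obtain rfl : m = 0 := by omega
      simpa using h
    rw [hzero]
    exact zero_mem _
  | succ k ih =>
    have hstep : ∀ n, ∃ a : ℤ, (a = 0 ∨ a ∈ S ∨ -a ∈ S) ∧ ∃ m : ℕ, m ≤ k ∧
        ∃ t : Fin m → ℤ, (∀ i, t i ∈ S ∨ -t i ∈ S) ∧ f n - a = ∑ i, t i := by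
      intro n
      obtain ⟨m, hm, t, ht, h⟩ := hf n
      cases m with
      | zero => exact ⟨0, Or.inl rfl, 0, Nat.zero_le k, t, ht, by simpa using h⟩
      | succ m =>
        refine ⟨t 0, Or.inr (ht 0), m, by omega, fun i => t i.succ, fun i => ht i.succ, ?_⟩
        rw [h, Fin.sum_univ_succ]
        ring
    choose g hg hrest using hstep
    rw [← sub_add_cancel f g]
    exact add_mem (ih (f - g) hrest) (mem_closure_of_forall_eq_zero_or_mem_or_neg_mem S g hg)

/-- Let `S` be a set of integers and `G_S` the subgroup of `ℤ^ℕ` generated by the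
functions with values in `{0} ∪ S`.  Then `G_S` consists exactly of the `f : ℕ → ℤ`
for which there is a `k` such that every value of `f` is a sum of at most `k` terms
(counting repetitions) from `S ∪ (−S)`. -/
theorem subgroup_generated_by_S_valued_functions
    (S : Set ℤ) :
    (AddSubgroup.closure {f : ℕ → ℤ | ∀ n, f n = 0 ∨ f n ∈ S} : Set (ℕ → ℤ)) =
      {f : ℕ → ℤ | ∃ k : ℕ, ∀ n : ℕ, ∃ m : ℕ, m ≤ k ∧
        ∃ t : Fin m → ℤ, (∀ i, t i ∈ S ∨ -t i ∈ S) ∧ f n = ∑ i, t i} := by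
  apply Set.Subset.antisymm
  · intro f hf
    induction hf using AddSubgroup.closure_induction with
    | mem f hf =>
      refine ⟨1, fun n => ?_⟩
      rcases hf n with h | h
      · exact ⟨0, by omega, Fin.elim0, fun i => i.elim0, by simpa using h⟩
      · exact ⟨1, le_rfl, fun _ => f n, fun _ => Or.inl h, by simp⟩
    | zero => exact ⟨0, fun n => ⟨0, le_rfl, Fin.elim0, fun i => i.elim0, by simp⟩⟩
    | add f g _ _ hf hg =>
      obtain ⟨k, hk⟩ := hf
      obtain ⟨l, hl⟩ := hg
      refine ⟨k + l, fun n => ?_⟩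
      obtain ⟨a, ha, s, hs, hfs⟩ := hk n
      obtain ⟨b, hb, t, ht, hgt⟩ := hl n
      refine ⟨a + b, by omega, Fin.append s t, fun i => ?_, ?_⟩
      · refine Fin.addCases (fun i => ?_) (fun i => ?_) i
        · simpa using hs i
        · simpa using ht i
      · simp [Fin.sum_univ_add, hfs, hgt]
    | neg f _ hf =>
      obtain ⟨k, hk⟩ := hf
      refine ⟨k, fun n => ?_⟩
      obtain ⟨a, ha, s, hs, hfs⟩ := hk n
      exact ⟨a, ha, fun i => -s i, fun i => by simpa using (hs i).symm, by simp [hfs]⟩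
  · rintro f ⟨k, hk⟩
    exact mem_closure_of_forall_eq_sum S k f hk
end

section
/- Let S = {n² : n ∈ ℤ} be the set of squares of integers, and let G_S be the additive subgroup of ℤ^ℕ generated by the set ({0} ∪ S)^ℕ of all functions ℕ → ℤ taking values in {0} ∪ S. Then G_S is the full group ℤ^ℕ. -/
/-- Every integer has the form `a² - b² + c²`. -/
theorem Int.exists_eq_sq_sub_sq_add_sq (z : ℤ) : ∃ a b c : ℤ, z = a ^ 2 - b ^ 2 + c ^ 2 := by
  obtain ⟨k, rfl | rfl⟩ := Int.even_or_odd' z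
  · exact ⟨k, k - 1, 1, by ring⟩
  · exact ⟨k + 1, k, 0, by ring⟩

/-- Let `S` be the set of squares of integers.  Then the subgroup of `ℤ^ℕ` generated by
the functions with values in `{0} ∪ S` is all of `ℤ^ℕ`. -/
theorem subgroup_generated_by_square_valued_functions_eq_top :
    AddSubgroup.closure {f : ℕ → ℤ | ∀ n, f n = 0 ∨ f n ∈ {z : ℤ | ∃ m : ℤ, z = m ^ 2}} =
      (⊤ : AddSubgroup (ℕ → ℤ)) := by
  refine (AddSubgroup.eq_top_iff' _).2 fun f => ?_
  choose a b c h using fun n => Int.exists_eq_sq_sub_sq_add_sq (f n)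
  have hf : f = a ^ 2 - b ^ 2 + c ^ 2 := funext h
  have sq_mem (g : ℕ → ℤ) : g ^ 2 ∈ AddSubgroup.closure
      {f : ℕ → ℤ | ∀ n, f n = 0 ∨ f n ∈ {z : ℤ | ∃ m : ℤ, z = m ^ 2}} :=
    AddSubgroup.subset_closure fun n => Or.inr ⟨g n, rfl⟩
  rw [hf]
  exact add_mem (sub_mem (sq_mem a) (sq_mem b)) (sq_mem c)
end
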